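/- For any constant c ≥ 2 there exists a choice of the constant C in the definition of ε = 1/(C·ln N) such that the following holds. Let 0 ≤ p, p₀ with p + p₀ ≤ 1, let F: ℝ^{2N} → ℝ be a multilinear function mapping {±1}^{2N} into [−1, 1], and let z₀ ∈ [−p₀, p₀]^{2N}. Then E_{z ~ G'}[ |F(trnc(z₀ + p·z)) − F(z₀ + p·z)| ] ≤ 8·N^{−c}. -/

import Mathlib

open MeasureTheory ProbabilityTheory Finset

noncomputable section

/-- Bit strings of length `n`; there are `N = 2^n` of them. -/
abbrev BV (n : ℕ) := Fin n → Bool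

/-- Inner product (mod nothing, just the count) of two bit strings. -/
def bip {n : ℕ} (x y : BV n) : ℕ := (Finset.univ.filter fun i => x i && y i).card

/-- The `N × N` normalized Walsh-Hadamard matrix, `H_{x,y} = (-1)^{⟨x,y⟩} / √N`. -/
def Had (n : ℕ) : Matrix (BV n) (BV n) ℝ :=
  Matrix.of fun x y => (-1 : ℝ) ^ bip x y / Real.sqrt (2 ^ n)

/-- `ε = 1 / (C ln N)` with `N = 2^n`. -/
def eps (C : ℝ) (n : ℕ) : ℝ := 1 / (C * Real.log (2 ^ n))

/-- The Gaussian vector `X` with i.i.d. `N(0, ε)` coordinates. -/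
def gaussVec (C : ℝ) (n : ℕ) : Measure (BV n → ℝ) :=
  Measure.pi fun _ => gaussianReal 0 (eps C n).toNNReal

/-- The distribution `G'` of `Z = (X, Y∘Y - ε·𝟙)` with `Y = H·X`, packed as a
function on `BV n ⊕ BV n` (first `N` coordinates are `X`, last `N` are `Y∘Y - ε`). -/
def Gmeas' (C : ℝ) (n : ℕ) : Measure (BV n ⊕ BV n → ℝ) :=
  (gaussVec C n).map fun X => Sum.elim X fun i => ((Had n).mulVec X i) ^ 2 - eps C n

/-- Truncation to `[-1, 1]`. -/
def trnc (a : ℝ) : ℝ := min 1 (max (-1) a)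

/-- Randomized rounding of `a` to `±1`: output `1` with probability `(1 + trnc a)/2`
and `-1` with probability `(1 - trnc a)/2`. -/
def roundM (a : ℝ) : Measure ℝ :=
  ((1 + trnc a) / 2).toNNReal • Measure.dirac 1 +
    ((1 - trnc a) / 2).toNNReal • Measure.dirac (-1)

/-- The distribution `D` on `{±1}^{2N}`: sample `z ~ G'` and round each coordinate
independently. -/
def Dmeas (C : ℝ) (n : ℕ) : Measure (BV n ⊕ BV n → ℝ) :=
  (Gmeas' C n).bind fun z => Measure.pi fun i => roundM (z i)

/-- `F : ℝ^ι → ℝ` is multilinear if `F z = Σ_S F̂(S) ∏_{i ∈ S} z_i`. -/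
def IsMultilinear {ι : Type*} [Fintype ι] [DecidableEq ι] (F : (ι → ℝ) → ℝ) : Prop :=
  ∃ c : Finset ι → ℝ, ∀ z, F z = ∑ S : Finset ι, c S * ∏ i ∈ S, z i

/-- The Fourier coefficient `F̂(S)` of `F` (over the hypercube `{±1}^ι`); for a
multilinear `F` these are precisely its multilinear coefficients. -/
def mlCoeff {ι : Type*} [Fintype ι] [DecidableEq ι] (F : (ι → ℝ) → ℝ) (S : Finset ι) : ℝ :=
  (∑ z : ι → Bool, F (fun i => if z i then 1 else -1) * ∏ i ∈ S, (if z i then (1 : ℝ) else -1)) /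
    2 ^ Fintype.card ι

/-- `L_{1,2}(F) = Σ_{|S| = 2} |F̂(S)|`. -/
def L12 {ι : Type*} [Fintype ι] [DecidableEq ι] (F : (ι → ℝ) → ℝ) : ℝ :=
  ∑ S ∈ Finset.univ.filter (fun S : Finset ι => S.card = 2), |mlCoeff F S|

/-- The restriction `F_ρ` of `F` under `ρ = (S, w)`: coordinates outside `S` are
fixed to the values of `w`. -/
def restrictML {ι : Type*} [DecidableEq ι] (F : (ι → ℝ) → ℝ) (S : Finset ι)
    (w : ι → ℝ) : (ι → ℝ) → ℝ :=
  fun y => F fun i => if i ∈ S then y i else w i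

/-- `φ(X, Y) = (1/N) Σ_i (Σ_j H_{ij} X_j)² Y_i`. -/
def phi (n : ℕ) (X Y : BV n → ℝ) : ℝ :=
  (∑ i, ((Had n).mulVec X i) ^ 2 * Y i) / 2 ^ n

/-- The multilinear part `φ_{i≠j}(X, Y) = (1/N) Σ_i Σ_{j ≠ k} H_{ij} H_{ik} X_j X_k Y_i`. -/
def phiOff (n : ℕ) (X Y : BV n → ℝ) : ℝ :=
  (∑ i, ∑ j, ∑ k ∈ Finset.univ \ {j}, Had n i j * Had n i k * X j * X k * Y i) / 2 ^ n

/-- The Fourier coefficient `f̂(x) = 2^{-n} Σ_y f(y) (-1)^{⟨x,y⟩}` of `f : {0,1}^n → {±1}`. -/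
def hatF (n : ℕ) (f : BV n → ℝ) (x : BV n) : ℝ :=
  (∑ y, f y * (-1 : ℝ) ^ bip x y) / 2 ^ n

lemma trnc_eq_self {a : ℝ} (ha : |a| ≤ 1) : trnc a = a := by
  rw [abs_le] at ha
  rw [trnc, max_eq_right ha.1, min_eq_right ha.2]

lemma abs_trnc_le_one (a : ℝ) : |trnc a| ≤ 1 := by
  rw [abs_le, trnc]
  exact ⟨le_min (by norm_num) (le_max_left _ _), min_le_left _ _⟩

lemma abs_one_add_add_abs_one_sub (t : ℝ) : |1 + t| + |1 - t| = 2 * max 1 |t| := by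
  rcases le_total |t| 1 with h | h
  · rw [max_eq_left h]
    rw [abs_le] at h
    rw [abs_of_nonneg (by linarith), abs_of_nonneg (by linarith)]
    ring
  · rw [max_eq_right h]
    rcases le_abs.1 h with h | h
    · rw [abs_of_nonneg (by linarith : 0 ≤ 1 + t), abs_of_nonpos (by linarith : 1 - t ≤ 0),
        abs_of_nonneg (by linarith : 0 ≤ t)]
      ring
    · rw [abs_of_nonpos (by linarith : 1 + t ≤ 0), abs_of_nonneg (by linarith : 0 ≤ 1 - t),
        abs_of_nonpos (by linarith : t ≤ 0)]
      ring

lemma trnc_sub_eq_zero {ι : Type*} (F : (ι → ℝ) → ℝ) {p p₀ : ℝ} (hp : 0 ≤ p)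
    (hpp : p + p₀ ≤ 1) {z₀ : ι → ℝ} (hz₀ : ∀ i, |z₀ i| ≤ p₀) {z : ι → ℝ} (hz : ∀ i, |z i| ≤ 1) :
    F (fun i => trnc (z₀ i + p * z i)) - F (fun i => z₀ i + p * z i) = 0 := by
  have : ∀ i, trnc (z₀ i + p * z i) = z₀ i + p * z i := fun i => by
    apply trnc_eq_self
    calc |z₀ i + p * z i| ≤ |z₀ i| + |p * z i| := abs_add_le _ _
      _ ≤ p₀ + p * 1 := by
        rw [abs_mul, abs_of_nonneg hp]
        gcongr
        exacts [hz₀ i, hz i]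
      _ ≤ 1 := by linarith
  simp only [this, sub_self]

namespace IsMultilinear

variable {ι : Type*} [Fintype ι] [DecidableEq ι] {F : (ι → ℝ) → ℝ}

lemma eq_update (hF : IsMultilinear F) (w : ι → ℝ) (j : ι) :
    F w = (1 + w j) / 2 * F (Function.update w j 1)
      + (1 - w j) / 2 * F (Function.update w j (-1)) := by
  obtain ⟨c, hc⟩ := hF
  simp only [hc, Finset.mul_sum, ← Finset.sum_add_distrib]
  refine Finset.sum_congr rfl fun S _ => ?_
  by_cases hj : j ∈ S
  · rw [Finset.prod_update_of_mem hj, Finset.prod_update_of_mem hj,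
      ← Finset.mul_prod_erase S w hj, Finset.sdiff_singleton_eq_erase]
    ring
  · rw [Finset.prod_update_of_notMem hj, Finset.prod_update_of_notMem hj]
    ring

lemma abs_le_prod_subset (hF : IsMultilinear F)
    (hb : ∀ z : ι → ℝ, (∀ i, z i = 1 ∨ z i = -1) → |F z| ≤ 1) (T : Finset ι) :
    ∀ w : ι → ℝ, (∀ i ∉ T, w i = 1 ∨ w i = -1) → |F w| ≤ ∏ i ∈ T, max 1 |w i| := by
  induction T using Finset.induction_on with
  | empty => exact fun w hw => by simpa using hb w fun i => hw i (Finset.notMem_empty i)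
  | insert j T hj ih =>
    intro w hw
    have key : ∀ s : ℝ, (s = 1 ∨ s = -1) →
        |F (Function.update w j s)| ≤ ∏ i ∈ T, max 1 |w i| := by
      intro s hs
      refine (ih _ fun i hi => ?_).trans_eq (Finset.prod_congr rfl fun i hi => ?_)
      · by_cases hij : i = j
        · subst hij; simpa using hs
        · simpa [hij] using hw i (by simp [hij, hi])
      · rw [Function.update_of_ne (by rintro rfl; exact hj hi)]
    have h1 := key 1 (Or.inl rfl)
    have h2 := key (-1) (Or.inr rfl)
    rw [Finset.prod_insert hj, hF.eq_update w j]
    set M := ∏ i ∈ T, max 1 |w i|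
    calc _ ≤ |1 + w j| / 2 * M + |1 - w j| / 2 * M := by
          refine (abs_add_le _ _).trans ?_
          rw [abs_mul, abs_mul, abs_div, abs_div, abs_two]
          gcongr
      _ = (|1 + w j| + |1 - w j|) / 2 * M := by ring
      _ = _ := by rw [abs_one_add_add_abs_one_sub]; ring

lemma abs_le_prod (hF : IsMultilinear F)
    (hb : ∀ z : ι → ℝ, (∀ i, z i = 1 ∨ z i = -1) → |F z| ≤ 1) (w : ι → ℝ) :
    |F w| ≤ ∏ i, max 1 |w i| :=
  hF.abs_le_prod_subset hb Finset.univ w fun i hi => absurd (Finset.mem_univ i) hi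

lemma abs_trnc_sub_le (hF : IsMultilinear F)
    (hb : ∀ z : ι → ℝ, (∀ i, z i = 1 ∨ z i = -1) → |F z| ≤ 1) {p p₀ : ℝ} (hp : 0 ≤ p)
    (hp₀ : 0 ≤ p₀) (hpp : p + p₀ ≤ 1) {z₀ : ι → ℝ} (hz₀ : ∀ i, |z₀ i| ≤ p₀) (z : ι → ℝ) :
    |F (fun i => trnc (z₀ i + p * z i)) - F (fun i => z₀ i + p * z i)|
      ≤ 2 * ∏ i, max 1 |z i| := by
  have hle : ∀ i, |z₀ i + p * z i| ≤ max 1 |z i| := fun i => by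
    calc |z₀ i + p * z i| ≤ |z₀ i| + |p * z i| := abs_add_le _ _
      _ ≤ p₀ * max 1 |z i| + p * max 1 |z i| := by
        rw [abs_mul, abs_of_nonneg hp]
        gcongr
        · exact (hz₀ i).trans (le_mul_of_one_le_right hp₀ (le_max_left _ _))
        · exact le_max_right _ _
      _ ≤ max 1 |z i| := by
        rw [← add_mul]
        exact mul_le_of_le_one_left (by positivity) (by linarith)
  have h1 : |F (fun i => trnc (z₀ i + p * z i))| ≤ ∏ i, max 1 |z i| :=
    (hF.abs_le_prod hb _).trans (Finset.prod_le_prod (fun i _ => by positivity) fun i _ =>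
      max_le (le_max_left _ _) ((abs_trnc_le_one _).trans (le_max_left _ _)))
  have h2 : |F (fun i => z₀ i + p * z i)| ≤ ∏ i, max 1 |z i| :=
    (hF.abs_le_prod hb _).trans (Finset.prod_le_prod (fun i _ => by positivity) fun i _ =>
      max_le (le_max_left _ _) (hle i))
  linarith [abs_sub (F (fun i => trnc (z₀ i + p * z i))) (F (fun i => z₀ i + p * z i))]

end IsMultilinear

/-- The envelope `∏ᵢ (1 + exp (s (uᵢ² - 1))) - 1` that dominates products of large coordinates. -/
def expEnvelope {ι : Type*} [Fintype ι] (s : ℝ) (u : ι → ℝ) : ℝ :=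
  ∏ i, (1 + Real.exp (s * (u i ^ 2 - 1))) - 1

section Envelope

variable {ι : Type*} [Fintype ι]

lemma expEnvelope_nonneg (s : ℝ) (u : ι → ℝ) : 0 ≤ expEnvelope s u :=
  sub_nonneg.2 (Finset.one_le_prod fun i _ => by
    simpa using (Real.exp_pos (s * (u i ^ 2 - 1))).le)

lemma prod_le_prod_one_add_sub_one {a e : ι → ℝ} (ha : ∀ i, 1 ≤ a i) (he : ∀ i, 0 ≤ e i)
    (hae : ∀ i, 1 < a i → a i ≤ e i) (h : 1 < ∏ i, a i) :
    ∏ i, a i ≤ ∏ i, (1 + e i) - 1 := by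
  classical
  have hle : ∀ i, a i ≤ 1 + e i := fun i => by
    rcases (ha i).eq_or_lt with h | h
    · linarith [he i]
    · linarith [hae i h]
  obtain ⟨j, hj⟩ : ∃ j, 1 < a j := by
    by_contra! hcon
    exact h.ne' (Finset.prod_eq_one fun i _ => le_antisymm (hcon i) (ha i))
  rw [← Finset.mul_prod_erase _ _ (Finset.mem_univ j),
    ← Finset.mul_prod_erase _ (fun i => 1 + e i) (Finset.mem_univ j)]
  have h1 : (1 : ℝ) ≤ ∏ i ∈ Finset.univ.erase j, a i :=
    Finset.one_le_prod fun i _ => ha i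
  have h2 : ∏ i ∈ Finset.univ.erase j, a i ≤ ∏ i ∈ Finset.univ.erase j, (1 + e i) :=
    Finset.prod_le_prod (fun i _ => zero_le_one.trans (ha i)) fun i _ => hle i
  nlinarith [hae j hj]

lemma sq_le_exp_of_one_lt {s x : ℝ} (hs : 2 ≤ s) (hx : 1 < x ^ 2) :
    (x ^ 2) ^ 2 ≤ Real.exp (s * (x ^ 2 - 1)) := by
  have h := Real.add_one_le_exp (x ^ 2 - 1)
  calc (x ^ 2) ^ 2 ≤ Real.exp (x ^ 2 - 1) ^ 2 := by gcongr; linarith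
    _ = Real.exp (2 * (x ^ 2 - 1)) := by rw [← Real.exp_nat_mul]; norm_num
    _ ≤ _ := Real.exp_le_exp.2 (by nlinarith)

lemma prod_max_one_sq_le_expEnvelope {s : ℝ} (u v : ι → ℝ)
    (huv : ∀ i, 1 < |v i| → v i ^ 2 ≤ Real.exp (s * (u i ^ 2 - 1)))
    (h : 1 < ∏ i, max 1 |v i|) :
    (∏ i, max 1 |v i|) ^ 2 ≤ expEnvelope s u := by
  rw [← Finset.prod_pow]
  refine prod_le_prod_one_add_sub_one (fun i => one_le_pow₀ (le_max_left _ _))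
    (fun i => (Real.exp_pos _).le) (fun i hi => ?_) ?_
  · rcases le_or_gt |v i| 1 with hv | hv
    · simp [max_eq_left hv] at hi
    · rw [max_eq_right hv.le, sq_abs]
      exact huv i hv
  · rw [Finset.prod_pow]
    exact one_lt_pow₀ h two_ne_zero

lemma one_le_prod_max_one_abs (v : ι → ℝ) : 1 ≤ ∏ i, max 1 |v i| :=
  Finset.one_le_prod fun _ _ => le_max_left _ _

lemma prod_max_one_sumElim_le {s ε : ℝ} (hs : 2 ≤ s) (hε : 0 ≤ ε) (hε1 : ε ≤ 1) (x y : ι → ℝ)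
    (h : ∃ k, 1 < |Sum.elim x (fun i => y i ^ 2 - ε) k|) :
    ∏ k, max 1 |Sum.elim x (fun i => y i ^ 2 - ε) k| ≤ expEnvelope s x + expEnvelope s y := by
  have hx : ∀ i, 1 < |x i| → x i ^ 2 ≤ Real.exp (s * (x i ^ 2 - 1)) := fun i hi => by
    have h1 := one_lt_sq_iff_one_lt_abs (x i) |>.2 hi
    exact (le_self_pow₀ h1.le two_ne_zero).trans (sq_le_exp_of_one_lt hs h1)
  have hy : ∀ i, 1 < |y i ^ 2 - ε| → (y i ^ 2 - ε) ^ 2 ≤ Real.exp (s * (y i ^ 2 - 1)) :=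
    fun i hi => by
      have h1 : 1 < y i ^ 2 - ε := by
        rcases lt_abs.1 hi with h | h
        · exact h
        · nlinarith [sq_nonneg (y i)]
      refine le_trans ?_ (sq_le_exp_of_one_lt hs (by linarith))
      gcongr
      linarith
  have hA := one_le_prod_max_one_abs x
  have hB := one_le_prod_max_one_abs fun i => y i ^ 2 - ε
  have hX := prod_max_one_sq_le_expEnvelope x x hx
  have hY := prod_max_one_sq_le_expEnvelope y _ hy
  have hAB : 1 < ∏ k, max 1 |Sum.elim x (fun i => y i ^ 2 - ε) k| := by
    obtain ⟨k, hk⟩ := h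
    classical
    rw [← Finset.mul_prod_erase _ _ (Finset.mem_univ k)]
    exact one_lt_mul_of_lt_of_le (lt_max_of_lt_right hk)
      (Finset.one_le_prod fun _ _ => le_max_left _ _)
  have h0x := expEnvelope_nonneg s x
  have h0y := expEnvelope_nonneg s y
  rw [Fintype.prod_sum_type] at hAB ⊢
  simp only [Sum.elim_inl, Sum.elim_inr] at hAB ⊢
  set A := ∏ i, max 1 |x i|
  set B := ∏ i, max 1 |y i ^ 2 - ε|
  rcases le_total A B with hle | hle
  · have := hY (by nlinarith)
    nlinarith
  · have := hX (by nlinarith)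
    nlinarith

end Envelope

section Gaussian

open scoped NNReal

lemma integrable_and_integral_exp_sq_gaussianReal {v : ℝ≥0} (hv : v ≠ 0) :
    Integrable (fun x : ℝ => Real.exp (x ^ 2 / (4 * v))) (gaussianReal 0 v) ∧
      ∫ x, Real.exp (x ^ 2 / (4 * v)) ∂(gaussianReal 0 v) = Real.sqrt 2 := by
  have hv' : (0 : ℝ) < v := by positivity
  have hfun : (fun x : ℝ => gaussianPDFReal 0 v x • Real.exp (x ^ 2 / (4 * v)))
      = fun x => (Real.sqrt (2 * Real.pi * v))⁻¹ * Real.exp (-(1 / (4 * v)) * x ^ 2) := by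
    ext x
    rw [gaussianPDFReal, smul_eq_mul, mul_assoc, ← Real.exp_add]
    congr 2
    field_simp
    ring
  constructor
  · rw [gaussianReal_of_var_ne_zero _ hv,
      integrable_withDensity_iff_integrable_smul₀' (by fun_prop)
        (ae_of_all _ fun _ => gaussianPDF_lt_top)]
    simp only [toReal_gaussianPDF]
    rw [hfun]
    exact (integrable_exp_neg_mul_sq (by positivity)).const_mul _
  · rw [integral_gaussianReal_eq_integral_smul hv, hfun, integral_const_mul, integral_gaussian,
      ← Real.sqrt_inv, ← Real.sqrt_mul (by positivity)]
    congr 1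
    field_simp
    norm_num

variable {ι : Type*} [Fintype ι]

lemma integrable_and_integral_expEnvelope {v : ℝ≥0} (hv : v ≠ 0) :
    Integrable (fun u : ι → ℝ => expEnvelope (1 / (4 * v)) u)
      (Measure.pi fun _ => gaussianReal 0 v) ∧
    ∫ u : ι → ℝ, expEnvelope (1 / (4 * v)) u ∂(Measure.pi fun _ => gaussianReal 0 v)
      = (1 + Real.sqrt 2 * Real.exp (-(1 / (4 * v)))) ^ Fintype.card ι - 1 := by
  obtain ⟨hi, hI⟩ := integrable_and_integral_exp_sq_gaussianReal hv
  have hfun : (fun x : ℝ => 1 + Real.exp (1 / (4 * v) * (x ^ 2 - 1)))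
      = fun x => 1 + Real.exp (x ^ 2 / (4 * v)) * Real.exp (-(1 / (4 * v))) := by
    ext x
    rw [← Real.exp_add]
    congr 2
    ring
  have hint : Integrable (fun x : ℝ => 1 + Real.exp (1 / (4 * v) * (x ^ 2 - 1)))
      (gaussianReal 0 v) := by
    rw [hfun]
    exact (integrable_const _).add (hi.mul_const _)
  have hprod : Integrable (fun u : ι → ℝ => ∏ i, (1 + Real.exp (1 / (4 * v) * (u i ^ 2 - 1))))
      (Measure.pi fun _ => gaussianReal 0 v) := Integrable.fintype_prod fun _ => hint
  refine ⟨hprod.sub (integrable_const _), ?_⟩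
  simp only [expEnvelope]
  rw [integral_sub hprod (integrable_const _),
    integral_fintype_prod_eq_prod
      (f := fun (_ : ι) (x : ℝ) => 1 + Real.exp (1 / (4 * v) * (x ^ 2 - 1))), hfun,
    integral_add (integrable_const _) (hi.mul_const _), integral_mul_const, hI]
  simp

/-- The i.i.d. centered Gaussian law is invariant under orthogonal matrices. -/
lemma map_mulVec_pi_gaussianReal [DecidableEq ι] (v : ℝ≥0) {A : Matrix ι ι ℝ}
    (hA : A * A.transpose = 1) :
    (Measure.pi fun _ : ι => gaussianReal 0 v).map (fun x => A.mulVec x)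
      = Measure.pi fun _ => gaussianReal 0 v := by
  have hmeas : Measurable fun x : ι → ℝ => A.mulVec x :=
    (Continuous.matrix_mulVec continuous_const continuous_id).measurable
  have : IsProbabilityMeasure
      ((Measure.pi fun _ : ι => gaussianReal 0 v).map (fun x => A.mulVec x)) :=
    Measure.isProbabilityMeasure_map hmeas.aemeasurable
  refine charFun_eq_pi_iff.1 fun t => ?_
  have hrot : charFun
      (((Measure.pi fun _ : ι => gaussianReal 0 v).map fun x => A.mulVec x).map (WithLp.toLp 2)) t
      = charFun ((Measure.pi fun _ : ι => gaussianReal 0 v).map (WithLp.toLp 2))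
        (WithLp.toLp 2 (A.transpose.mulVec t.ofLp)) := by
    rw [charFun_apply, charFun_apply, ← MeasurableEquiv.coe_toLp, integral_map_equiv,
      integral_map_equiv, integral_map hmeas.aemeasurable (by fun_prop)]
    refine integral_congr_ae (ae_of_all _ fun x => ?_)
    have : inner ℝ (WithLp.toLp 2 (A.mulVec x)) t
        = inner ℝ (WithLp.toLp 2 x) (WithLp.toLp 2 (A.transpose.mulVec t.ofLp)) := by
      rw [EuclideanSpace.inner_eq_star_dotProduct, EuclideanSpace.inner_eq_star_dotProduct]
      simp [Matrix.mulVec_transpose, Matrix.dotProduct_mulVec]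
    simp [this]
  have hsq : ∑ i, (A.transpose.mulVec t.ofLp i) ^ 2 = ∑ i, t i ^ 2 := by
    have : A.transpose.mulVec t.ofLp ⬝ᵥ A.transpose.mulVec t.ofLp = t.ofLp ⬝ᵥ t.ofLp := by
      rw [Matrix.dotProduct_mulVec, Matrix.vecMul_transpose, Matrix.mulVec_mulVec, hA,
        Matrix.one_mulVec]
    simpa [dotProduct, sq] using this
  rw [hrot, charFun_pi]
  simp_rw [charFun_gaussianReal, ← Complex.exp_sum]
  congr 1
  simp only [Complex.ofReal_zero, mul_zero, zero_mul, zero_sub, Finset.sum_neg_distrib,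
    ← Finset.sum_div, ← Finset.mul_sum]
  exact_mod_cast congrArg (fun r : ℝ => -((((v : ℝ) * r : ℝ) : ℂ) / 2)) hsq

end Gaussian

section Hadamard

lemma neg_one_pow_bip {n : ℕ} (x y : BV n) :
    (-1 : ℝ) ^ bip x y = ∏ i, if x i && y i then (-1 : ℝ) else 1 := by
  rw [bip, Finset.prod_ite]
  simp

lemma sum_neg_one_pow_bip_mul {n : ℕ} (x z : BV n) :
    ∑ y : BV n, (-1 : ℝ) ^ bip x y * (-1) ^ bip z y = if x = z then 2 ^ n else 0 := by
  simp_rw [neg_one_pow_bip, ← Finset.prod_mul_distrib]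
  rw [← Fintype.prod_sum fun (i : Fin n) (b : Bool) =>
    (if x i && b then (-1 : ℝ) else 1) * if z i && b then (-1 : ℝ) else 1]
  split_ifs with h
  · subst h
    have h2 : ∀ i, ∑ b : Bool, (if x i && b then (-1 : ℝ) else 1) *
        (if x i && b then (-1 : ℝ) else 1) = 2 := fun i => by
      cases x i <;> norm_num
    rw [Finset.prod_congr rfl fun i _ => h2 i]
    simp
  · obtain ⟨i, hi⟩ := Function.ne_iff.1 h
    refine Finset.prod_eq_zero (Finset.mem_univ i) ?_
    revert hi
    cases x i <;> cases z i <;> norm_num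

lemma Had_mul_transpose (n : ℕ) : Had n * (Had n).transpose = 1 := by
  ext x z
  have h : (0 : ℝ) < 2 ^ n := by positivity
  rw [Matrix.mul_apply, Matrix.one_apply]
  simp only [Had, Matrix.transpose_apply, Matrix.of_apply, div_mul_div_comm,
    Real.mul_self_sqrt h.le]
  rw [← Finset.sum_div, sum_neg_one_pow_bip_mul]
  split_ifs <;> simp

end Hadamard

lemma integral_Gmeas'_le {C : ℝ} {n : ℕ} (hε : 0 < eps C n) (hε8 : eps C n ≤ 1 / 8)
    {p p₀ : ℝ} (hp : 0 ≤ p) (hp₀ : 0 ≤ p₀) (hpp : p + p₀ ≤ 1)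
    {F : (BV n ⊕ BV n → ℝ) → ℝ} (hF : IsMultilinear F)
    (hb : ∀ z : BV n ⊕ BV n → ℝ, (∀ i, z i = 1 ∨ z i = -1) → |F z| ≤ 1)
    {z₀ : BV n ⊕ BV n → ℝ} (hz₀ : ∀ i, |z₀ i| ≤ p₀) :
    ∫ z, |F (fun i => trnc (z₀ i + p * z i)) - F (fun i => z₀ i + p * z i)| ∂(Gmeas' C n)
      ≤ 4 * ((1 + Real.sqrt 2 * Real.exp (-(1 / (4 * eps C n)))) ^ 2 ^ n - 1) := by
  have hFm : Measurable F := by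
    obtain ⟨c, hc⟩ := hF
    rw [funext hc]
    fun_prop
  have hH : Measurable fun X : BV n → ℝ => (Had n).mulVec X :=
    (Continuous.matrix_mulVec continuous_const continuous_id).measurable
  have hmap : Measurable fun X : BV n → ℝ =>
      Sum.elim X fun i => ((Had n).mulVec X i) ^ 2 - eps C n := by
    refine measurable_pi_iff.2 fun k => ?_
    rcases k with i | i
    · exact measurable_pi_apply i
    · exact (((measurable_pi_apply i).comp hH).pow_const 2).sub_const _
  have htr : Measurable trnc := by unfold trnc; fun_prop
  have hv : (eps C n).toNNReal ≠ 0 := by simpa using hε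
  have hcoe : ((eps C n).toNNReal : ℝ) = eps C n := Real.coe_toNNReal _ hε.le
  set s : ℝ := 1 / (4 * eps C n) with hs_def
  have hs : 2 ≤ s := by
    rw [hs_def, le_div_iff₀ (by positivity)]
    linarith
  obtain ⟨hi, hI⟩ := integrable_and_integral_expEnvelope (ι := BV n) hv
  rw [hcoe, ← hs_def] at hi hI
  have hrot := map_mulVec_pi_gaussianReal (eps C n).toNNReal (Had_mul_transpose n)
  have hmp : MeasurePreserving (fun X : BV n → ℝ => (Had n).mulVec X) (gaussVec C n)
      (gaussVec C n) := ⟨hH, hrot⟩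
  have hi' : Integrable (fun X => expEnvelope s ((Had n).mulVec X)) (gaussVec C n) :=
    hmp.integrable_comp_of_integrable hi
  have hI' : ∫ X, expEnvelope s ((Had n).mulVec X) ∂(gaussVec C n)
      = ∫ X, expEnvelope s X ∂(gaussVec C n) := by
    conv_rhs => rw [← hmp.map_eq]
    rw [integral_map hH.aemeasurable]
    rw [hmp.map_eq]
    exact hi.aestronglyMeasurable
  have hg : Integrable (fun X => 2 * (expEnvelope s X + expEnvelope s ((Had n).mulVec X)))
      (gaussVec C n) := (hi.add hi').const_mul 2
  rw [Gmeas', integral_map hmap.aemeasurable (by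
    refine Measurable.aestronglyMeasurable ?_
    refine (Measurable.sub (hFm.comp ?_) (hFm.comp ?_)).abs
    · exact measurable_pi_iff.2 fun i => htr.comp (by fun_prop)
    · fun_prop)]
  refine (integral_mono_of_nonneg (ae_of_all _ fun _ => abs_nonneg _) hg
    (ae_of_all _ fun X => ?_)).trans_eq ?_
  · simp only
    by_cases h : ∃ k, 1 < |Sum.elim X (fun i => ((Had n).mulVec X i) ^ 2 - eps C n) k|
    · exact (hF.abs_trnc_sub_le hb hp hp₀ hpp hz₀ _).trans (mul_le_mul_of_nonneg_left
        (prod_max_one_sumElim_le hs hε.le (by linarith) X _ h) zero_le_two)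
    · push Not at h
      rw [trnc_sub_eq_zero F hp hpp hz₀ h, abs_zero]
      linarith [expEnvelope_nonneg s X, expEnvelope_nonneg s ((Had n).mulVec X)]
  · have hcard : Fintype.card (BV n) = 2 ^ n := by simp
    rw [hcard] at hI
    change ∫ X, expEnvelope s X ∂(gaussVec C n) = _ at hI
    rw [integral_const_mul, integral_add (μ := gaussVec C n) hi hi', hI', hI]
    ring

lemma one_add_pow_sub_one_le {δ : ℝ} (hδ : 0 ≤ δ) {m : ℕ} (h : m * δ ≤ 1) :
    (1 + δ) ^ m - 1 ≤ 2 * (m * δ) := by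
  have h0 : 0 ≤ m * δ := by positivity
  have h1 : (1 + δ) ^ m ≤ Real.exp (m * δ) := by
    rw [Real.exp_nat_mul]
    gcongr
    linarith [Real.add_one_le_exp δ]
  have h2 := Real.abs_exp_sub_one_le (x := m * δ) (by rwa [abs_of_nonneg h0])
  rw [abs_of_nonneg h0] at h2
  linarith [le_abs_self (Real.exp (m * δ) - 1)]

/-- For any constant `c ≥ 2` there exists a choice of the constant `C` in
the definition of `ε = 1/(C ln N)` such that: for `0 ≤ p, p₀` with `p + p₀ ≤ 1`, any
multilinear `F : ℝ^{2N} → ℝ` mapping `{±1}^{2N}` into `[-1,1]` and any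
`z₀ ∈ [-p₀, p₀]^{2N}`, `E_{z ~ G'}[|F(trnc(z₀ + p z)) - F(z₀ + p z)|] ≤ 8 N⁻ᶜ`. -/
theorem stmt8 :
    ∀ c : ℝ, 2 ≤ c → ∃ C : ℝ, 20 ≤ C ∧
      ∀ n : ℕ, 1 ≤ n →
      ∀ p p₀ : ℝ, 0 ≤ p → 0 ≤ p₀ → p + p₀ ≤ 1 →
      ∀ F : (BV n ⊕ BV n → ℝ) → ℝ, IsMultilinear F →
        (∀ z : BV n ⊕ BV n → ℝ, (∀ i, z i = 1 ∨ z i = -1) → |F z| ≤ 1) →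
      ∀ z₀ : BV n ⊕ BV n → ℝ, (∀ i, |z₀ i| ≤ p₀) →
        ∫ z, |F (fun i => trnc (z₀ i + p * z i)) - F (fun i => z₀ i + p * z i)|
            ∂(Gmeas' C n)
          ≤ 8 * (2 ^ n : ℝ) ^ (-c) := by
  intro c hc
  refine ⟨4 * c + 20, by linarith, fun n hn p p₀ hp hp₀ hpp F hF hb z₀ hz₀ => ?_⟩
  have hN : (2 : ℝ) ≤ 2 ^ n := by simpa using pow_le_pow_right₀ (one_le_two (α := ℝ)) hn
  have hN0 : (0 : ℝ) < 2 ^ n := by positivity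
  set L := Real.log (2 ^ n) with hL
  have hlog : 0.5 ≤ L := by
    have := Real.log_le_log two_pos hN
    linarith [Real.log_two_gt_d9]
  have hε : 0 < eps (4 * c + 20) n := by
    rw [eps, ← hL]
    positivity
  have hε8 : eps (4 * c + 20) n ≤ 1 / 8 := by
    rw [eps, ← hL]
    exact one_div_le_one_div_of_le (by norm_num) (by nlinarith)
  refine (integral_Gmeas'_le hε hε8 hp hp₀ hpp hF hb hz₀).trans ?_
  have hexp : Real.exp (-(1 / (4 * eps (4 * c + 20) n))) = (2 ^ n : ℝ) ^ (-c) / (2 ^ n) ^ 5 := by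
    rw [← Real.rpow_natCast (2 ^ n) 5, ← Real.rpow_sub hN0, Real.rpow_def_of_pos hN0, eps, ← hL]
    congr 1
    field_simp
    push_cast
    ring
  rw [hexp]
  set N : ℝ := 2 ^ n with hNdef
  set r := N ^ (-c) with hr
  have hr0 : 0 < r := Real.rpow_pos_of_pos hN0 _
  have hr1 : r ≤ 1 := Real.rpow_le_one_of_one_le_of_nonpos (by linarith) (by linarith)
  have hsqrt : Real.sqrt 2 ≤ 2 := Real.sqrt_le_iff.2 (by norm_num)
  have hδ : N * (Real.sqrt 2 * (r / N ^ 5)) ≤ r / 8 := by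
    have h4 : (16 : ℝ) ≤ N ^ 4 := by
      calc (16 : ℝ) = 2 ^ 4 := by norm_num
        _ ≤ N ^ 4 := by gcongr
    calc N * (Real.sqrt 2 * (r / N ^ 5)) = Real.sqrt 2 * (r / N ^ 4) := by field_simp
      _ ≤ 2 * (r / 16) := by gcongr
      _ = r / 8 := by ring
  have hcast : ((2 ^ n : ℕ) : ℝ) = N := by push_cast; rfl
  have := one_add_pow_sub_one_le (δ := Real.sqrt 2 * (r / N ^ 5)) (by positivity) (m := 2 ^ n)
    (by rw [hcast]; linarith)
  rw [hcast] at this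
  linarith
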